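/- For all real numbers a, b > 0 with a ≠ b, one has A + G − P < X < P²/A < (A+G)/2. -/

import Mathlib

open Real

/-- Arithmetic mean -/
noncomputable def Am (a b : ℝ) : ℝ := (a + b) / 2

/-- Geometric mean -/
noncomputable def Gm (a b : ℝ) : ℝ := Real.sqrt (a * b)

/-- Harmonic mean -/
noncomputable def Hm (a b : ℝ) : ℝ := 2 * a * b / (a + b)

/-- Seiffert mean -/
noncomputable def Pm (a b : ℝ) : ℝ := (a - b) / (2 * Real.arcsin ((a - b) / (a + b)))

/-- Sándor's X mean -/
noncomputable def Xm (a b : ℝ) : ℝ := Am a b * Real.exp (Gm a b / Pm a b - 1)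

/-- Logarithmic mean -/
noncomputable def Lm (a b : ℝ) : ℝ := (a - b) / (Real.log a - Real.log b)

/-- Identric mean -/
noncomputable def Im (a b : ℝ) : ℝ := (1 / Real.exp 1) * ((a ^ a) / (b ^ b)) ^ (1 / (a - b))

/-- Power mean -/
noncomputable def Mp (p a b : ℝ) : ℝ :=
  if p = 0 then Real.sqrt (a * b) else ((a ^ p + b ^ p) / 2) ^ (1 / p)

/-- Power-type Heronian mean -/
noncomputable def Hp (p a b : ℝ) : ℝ :=
  if p = 0 then Real.sqrt (a * b) else ((a ^ p + (a * b) ^ (p / 2) + b ^ p) / 3) ^ (1 / p)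

/-- A function continuous on `[0, c)` that vanishes at `0` and has positive derivative on `(0, c)`
is positive on `(0, c)`. -/
theorem pos_of_hasDerivAt_pos {f f' : ℝ → ℝ} {c : ℝ} (hcont : ContinuousOn f (Set.Ico 0 c))
    (hderiv : ∀ x, 0 < x → x < c → HasDerivAt f (f' x) x)
    (hpos : ∀ x, 0 < x → x < c → 0 < f' x) (h0 : f 0 = 0) {x : ℝ} (hx : 0 < x) (hxc : x < c) :
    0 < f x := by
  have hmono : StrictMonoOn f (Set.Ico 0 c) := by
    refine strictMonoOn_of_deriv_pos (convex_Ico 0 c) hcont fun y hy => ?_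
    rw [interior_Ico] at hy
    rw [(hderiv y hy.1 hy.2).deriv]
    exact hpos y hy.1 hy.2
  simpa [h0] using hmono ⟨le_rfl, hx.trans hxc⟩ ⟨hx.le, hxc⟩ hx

theorem hasDerivAt_sinc {x : ℝ} (hx : x ≠ 0) : HasDerivAt sinc ((cos x - sinc x) / x) x := by
  have h := (hasDerivAt_sin x).div (hasDerivAt_id x) hx
  have heq : sinc =ᶠ[nhds x] fun y => sin y / y := by
    filter_upwards [isOpen_ne.mem_nhds hx] with y hy using sinc_of_ne_zero hy
  refine (h.congr_of_eventuallyEq heq).congr_deriv ?_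
  rw [sinc_of_ne_zero hx]
  simp only [id]
  field_simp

theorem sinc_pos {x : ℝ} (hx : 0 ≤ x) (hx2 : x < π / 2) : 0 < sinc x := by
  rcases hx.eq_or_lt with rfl | h
  · simp
  · rw [sinc_of_ne_zero h.ne']
    exact div_pos (sin_pos_of_pos_of_lt_pi h (by linarith [pi_pos])) h

theorem sinc_lt_one {x : ℝ} (hx : 0 < x) : sinc x < 1 := by
  rw [sinc_of_ne_zero hx.ne', div_lt_one hx]
  exact sin_lt hx

theorem mul_cos_lt_sin {x : ℝ} (hx : 0 < x) (hx2 : x < π / 2) : x * cos x < sin x := by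
  have hc := cos_pos_of_mem_Ioo ⟨by linarith, hx2⟩
  have h := lt_tan hx hx2
  rwa [tan_eq_sin_div_cos, lt_div_iff₀ hc] at h

theorem three_mul_sin_mul_cos_lt {x : ℝ} (hx : 0 < x) (hx2 : x < π / 2) :
    3 * (sin x * cos x) < x * (1 + 2 * cos x ^ 2) := by
  have h := pos_of_hasDerivAt_pos (f := fun x => x * (1 + 2 * cos x ^ 2) - 3 * (sin x * cos x))
    (f' := fun x => 4 * sin x * (sin x - x * cos x)) (c := π / 2) (by fun_prop)
    (fun y _ _ => by
      have hs := hasDerivAt_sin y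
      have hc := hasDerivAt_cos y
      refine (((hasDerivAt_id y).mul (((hc.pow 2).const_mul 2).const_add 1)).sub
        ((hs.mul hc).const_mul 3)).congr_deriv ?_
      simp only [id, Pi.pow_apply]
      have := sin_sq_add_cos_sq y
      push_cast
      linear_combination -this)
    (fun y hy hy2 => by
      have h1 := sin_pos_of_pos_of_lt_pi hy (by linarith)
      have h2 := mul_cos_lt_sin hy hy2
      exact mul_pos (by linarith) (by linarith))
    (by simp) hx hx2
  linarith

theorem two_mul_sin_sq_lt {x : ℝ} (hx : 0 < x) (hx2 : x < π / 2) :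
    2 * sin x ^ 2 < x ^ 2 + x * (sin x * cos x) := by
  have h := pos_of_hasDerivAt_pos (f := fun x => x ^ 2 + x * (sin x * cos x) - 2 * sin x ^ 2)
    (f' := fun x => x * (1 + 2 * cos x ^ 2) - 3 * (sin x * cos x)) (c := π / 2) (by fun_prop)
    (fun y _ _ => by
      have hs := hasDerivAt_sin y
      have hc := hasDerivAt_cos y
      refine ((((hasDerivAt_id y).pow 2).add ((hasDerivAt_id y).mul (hs.mul hc))).sub
        ((hs.pow 2).const_mul 2)).congr_deriv ?_
      simp only [id, Pi.mul_apply]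
      have := sin_sq_add_cos_sq y
      push_cast
      linear_combination (-y) * this)
    (fun y hy hy2 => by linarith [three_mul_sin_mul_cos_lt hy hy2])
    (by simp) hx hx2
  linarith

theorem cos_div_sinc_sub_one_lt {x : ℝ} (hx : 0 < x) (hx2 : x < π / 2) :
    cos x / sinc x - 1 < 2 * log (sinc x) := by
  have h := pos_of_hasDerivAt_pos (f := fun x => 2 * log (sinc x) - cos x / sinc x + 1)
    (f' := fun x => (sinc x * cos x - 2 * sinc x ^ 2 + 1) / (x * sinc x ^ 2)) (c := π / 2)
    (by
      have hne : ∀ y ∈ Set.Ico 0 (π / 2), sinc y ≠ 0 := fun y hy => (sinc_pos hy.1 hy.2).ne'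
      have hs : ContinuousOn sinc (Set.Ico 0 (π / 2)) := continuous_sinc.continuousOn
      exact ((continuousOn_const.mul (hs.log hne)).sub
        (continuous_cos.continuousOn.div hs hne)).add continuousOn_const)
    (fun y hy hy2 => by
      have hs := hasDerivAt_sinc hy.ne'
      have hp := sinc_pos hy.le hy2
      refine ((((hs.log hp.ne').const_mul 2).sub
        ((hasDerivAt_cos y).div hs hp.ne')).add_const 1).congr_deriv ?_
      have hsin : sin y = sinc y * y := by rw [sinc_of_ne_zero hy.ne']; field_simp
      have := sin_sq_add_cos_sq y
      rw [hsin] at this ⊢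
      field_simp
      linear_combination this)
    (fun y hy hy2 => by
      have h1 := two_mul_sin_sq_lt hy hy2
      have hp := sinc_pos hy.le hy2
      have hsin : sin y = sinc y * y := by rw [sinc_of_ne_zero hy.ne']; field_simp
      rw [hsin] at h1
      refine div_pos ?_ (by positivity)
      have : 0 < y ^ 2 * (sinc y * cos y - 2 * sinc y ^ 2 + 1) := by linarith
      exact pos_of_mul_pos_right this (by positivity))
    (by simp) hx hx2
  linarith

theorem exp_cos_div_sinc_lt {x : ℝ} (hx : 0 < x) (hx2 : x < π / 2) :
    exp (cos x / sinc x - 1) < sinc x ^ 2 := by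
  have hp := sinc_pos hx.le hx2
  rw [← lt_log_iff_exp_lt (by positivity), log_pow]
  exact_mod_cast cos_div_sinc_sub_one_lt hx hx2

theorem sinc_eq_sinc_half_mul_cos_half {x : ℝ} (hx : x ≠ 0) :
    sinc x = sinc (x / 2) * cos (x / 2) := by
  have h : sin x = 2 * sin (x / 2) * cos (x / 2) := by rw [← sin_two_mul]; congr 1; ring
  rw [sinc_of_ne_zero hx, sinc_of_ne_zero (div_ne_zero hx two_ne_zero), h]
  field_simp

theorem one_add_cos_eq (x : ℝ) : 1 + cos x = 2 * cos (x / 2) ^ 2 := by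
  have h := cos_sq (x / 2)
  rw [show 2 * (x / 2) = x by ring] at h
  linarith

theorem sinc_sq_lt {x : ℝ} (hx : 0 < x) (hx2 : x < π / 2) : sinc x ^ 2 < (1 + cos x) / 2 := by
  have hc : 0 < cos (x / 2) := cos_pos_of_mem_Ioo ⟨by linarith, by linarith⟩
  have hp : 0 < sinc (x / 2) := sinc_pos (by linarith) (by linarith)
  have h1 : sinc (x / 2) < 1 := sinc_lt_one (by linarith)
  rw [sinc_eq_sinc_half_mul_cos_half hx.ne', one_add_cos_eq, mul_pow]
  have : sinc (x / 2) ^ 2 < 1 := by nlinarith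
  nlinarith [pow_pos hc 2]

theorem cos_lt_sinc_pow_three {x : ℝ} (hx : 0 < x) (hx1 : x ≤ 1) : cos x < sinc x ^ 3 := by
  have hc := (abs_le.1 (cos_bound (abs_le.2 ⟨by linarith, hx1⟩))).2
  rw [abs_of_pos hx] at hc
  have hs : 1 - x ^ 2 / 6 ≤ sinc x := by
    rw [sinc_of_ne_zero hx.ne', le_div_iff₀ hx]
    linarith [sin_gt_sub_cube hx]
  have hx2 : x ^ 2 ≤ 1 := by nlinarith
  have h3 : (1 - x ^ 2 / 6) ^ 3 ≤ sinc x ^ 3 := pow_le_pow_left₀ (by linarith) hs 3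
  have h4 := pow_pos hx 4
  nlinarith

theorem one_add_cos_lt {x : ℝ} (hx : 0 < x) (hx2 : x < π / 2) :
    1 + cos x < sinc x ^ 2 + sinc x := by
  have hc : 0 < cos (x / 2) := cos_pos_of_mem_Ioo ⟨by linarith, by linarith⟩
  have hp : 0 < sinc (x / 2) := sinc_pos (by linarith) (by linarith)
  have h3 := cos_lt_sinc_pow_three (x := x / 2) (by linarith) (by linarith [pi_lt_four])
  rw [sinc_eq_sinc_half_mul_cos_half hx.ne', one_add_cos_eq]
  generalize cos (x / 2) = c at *
  generalize sinc (x / 2) = s at *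
  have hsq : (2 * c) ^ 2 < (s ^ 2 * c + s) ^ 2 := by
    nlinarith [sq_nonneg (s ^ 2 * c - s), mul_lt_mul_of_pos_right h3 hc]
  have := lt_of_pow_lt_pow_left₀ 2 (by positivity) hsq
  nlinarith

theorem log_one_add_cos_sub_sinc_lt {x : ℝ} (hx : 0 < x) (hx2 : x < π / 2) :
    log (1 + cos x - sinc x) < cos x / sinc x - 1 := by
  have hpos : ∀ y ∈ Set.Ico 0 (π / 2), 0 < 1 + cos y - sinc y := fun y hy => by
    have := cos_pos_of_mem_Ioo (x := y) ⟨by linarith [hy.1, pi_pos], hy.2⟩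
    linarith [sinc_le_one y]
  have h := pos_of_hasDerivAt_pos (f := fun x => cos x / sinc x - 1 - log (1 + cos x - sinc x))
    (f' := fun x => (1 - sinc x) * (sinc x ^ 2 + sinc x - 1 - cos x) /
      (x * sinc x ^ 2 * (1 + cos x - sinc x))) (c := π / 2)
    (by
      have hne : ∀ y ∈ Set.Ico 0 (π / 2), sinc y ≠ 0 := fun y hy => (sinc_pos hy.1 hy.2).ne'
      have hs : ContinuousOn sinc (Set.Ico 0 (π / 2)) := continuous_sinc.continuousOn
      have hc : ContinuousOn cos (Set.Ico 0 (π / 2)) := continuous_cos.continuousOn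
      exact ((hc.div hs hne).sub continuousOn_const).sub
        (((continuousOn_const.add hc).sub hs).log fun y hy => (hpos y hy).ne'))
    (fun y hy hy2 => by
      have hs := hasDerivAt_sinc hy.ne'
      have hc := hasDerivAt_cos y
      have hp := sinc_pos hy.le hy2
      have hq := hpos y ⟨hy.le, hy2⟩
      refine (((hc.div hs hp.ne').sub_const 1).sub
        (((hc.const_add 1).sub hs).log hq.ne')).congr_deriv ?_
      have hsin : sin y = sinc y * y := by rw [sinc_of_ne_zero hy.ne']; field_simp
      have := sin_sq_add_cos_sq y
      rw [hsin] at this ⊢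
      have hq' := hq.ne'
      simp only [Pi.sub_apply]
      field_simp
      linear_combination (2 * sinc y - 1 - cos y) * this)
    (fun y hy hy2 => by
      have hp := sinc_pos hy.le hy2
      have hq := hpos y ⟨hy.le, hy2⟩
      have h1 := sinc_lt_one hy
      have h2 := one_add_cos_lt hy hy2
      exact div_pos (mul_pos (by linarith) (by linarith)) (by positivity))
    (by simp) hx hx2
  linarith

theorem one_add_cos_sub_sinc_lt {x : ℝ} (hx : 0 < x) (hx2 : x < π / 2) :
    1 + cos x - sinc x < exp (cos x / sinc x - 1) := by
  have hc := cos_pos_of_mem_Ioo (x := x) ⟨by linarith, hx2⟩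
  rw [← log_lt_iff_lt_exp (by linarith [sinc_le_one x])]
  exact log_one_add_cos_sub_sinc_lt hx hx2

theorem Am_comm (a b : ℝ) : Am a b = Am b a := by
  rw [Am, Am, add_comm]

theorem Gm_comm (a b : ℝ) : Gm a b = Gm b a := by
  rw [Gm, Gm, mul_comm]

theorem Pm_comm (a b : ℝ) : Pm a b = Pm b a := by
  rw [Pm, Pm, add_comm b a, ← neg_sub a b, neg_div (a + b), arcsin_neg, mul_neg, neg_div_neg_eq]

theorem Xm_comm (a b : ℝ) : Xm a b = Xm b a := by
  rw [Xm, Xm, Am_comm, Gm_comm, Pm_comm]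

/-- The means of `b < a` in terms of the angle `x = arcsin ((a - b) / (a + b))`. -/
theorem exists_angle {a b : ℝ} (hb : 0 < b) (hab : b < a) :
    ∃ x, 0 < x ∧ x < π / 2 ∧ Gm a b = Am a b * cos x ∧ Pm a b = Am a b * sinc x := by
  have hs : 0 < a + b := by linarith
  have hpos : 0 < (a - b) / (a + b) := div_pos (by linarith) hs
  have hlt : (a - b) / (a + b) < 1 := by rw [div_lt_one hs]; linarith
  have hx : 0 < arcsin ((a - b) / (a + b)) := arcsin_pos.2 hpos
  refine ⟨arcsin ((a - b) / (a + b)), hx, arcsin_lt_pi_div_two.2 hlt, ?_, ?_⟩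
  · rw [cos_arcsin, Gm, Am, sqrt_eq_iff_mul_self_eq (by nlinarith) (by positivity)]
    have h1 : 0 ≤ 1 - ((a - b) / (a + b)) ^ 2 := by nlinarith
    rw [mul_mul_mul_comm, mul_self_sqrt h1]
    field_simp
    ring
  · rw [sinc_of_ne_zero hx.ne', sin_arcsin (by linarith) hlt.le, Pm, Am]
    field_simp

theorem stmt_4 (a b : ℝ) (ha : 0 < a) (hb : 0 < b) (hab : a ≠ b) :
    Am a b + Gm a b - Pm a b < Xm a b ∧
    Xm a b < Pm a b ^ 2 / Am a b ∧
    Pm a b ^ 2 / Am a b < (Am a b + Gm a b) / 2 := by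
  wlog h : b < a generalizing a b
  · rw [Am_comm a b, Gm_comm a b, Pm_comm a b, Xm_comm a b]
    exact this b a hb ha hab.symm (lt_of_le_of_ne (not_lt.1 h) hab)
  obtain ⟨x, hx, hx2, hG, hP⟩ := exists_angle hb h
  have hA : 0 < Am a b := by unfold Am; linarith
  have hX : Xm a b = Am a b * exp (cos x / sinc x - 1) := by
    rw [Xm, hG, hP, mul_div_mul_left _ _ hA.ne']
  have hQ : (Am a b * sinc x) ^ 2 / Am a b = Am a b * sinc x ^ 2 := by field_simp
  rw [hX, hG, hP, hQ]
  refine ⟨?_, mul_lt_mul_of_pos_left (exp_cos_div_sinc_lt hx hx2) hA, ?_⟩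
  · have := mul_lt_mul_of_pos_left (one_add_cos_sub_sinc_lt hx hx2) hA
    linarith
  · have := mul_lt_mul_of_pos_left (sinc_sq_lt hx hx2) hA
    linarith
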